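/- arXiv:2404.11880 — 2 statements merged into one kernel-verified Lean document; each statement's English description precedes it below -/
import Mathlib

section
/- Assume S_U ⊆ (0, 1) and S_L ⊆ (0, 1), so that log is strictly negative on S_U ∪ S_L. Then Σ_{j=1}^k w_j Φ(f(A_j)) ≤ ( min_{x ∈ S_U} x/log x )·log(B_U), and Σ_{j=1}^k w_j Φ(f(A_j)) ≥ ( max_{x ∈ S_L} x/log x )·log(B_L), in the Loewner order, where log is applied to B_U and B_L via continuous functional calculus. -/
open ContinuousLinearMap in
/-- The Kantorovich constant `K(m', M', r)`, with the convention that it equals `1`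
for `r = 0` and `r = 1`. -/
noncomputable def kantorovich (m M r : ℝ) : ℝ :=
  if r = 0 ∨ r = 1 then 1 else
    ((m * M ^ r - M * m ^ r) / ((r - 1) * (M - m))) *
      (((r - 1) * (M ^ r - m ^ r)) / (r * (m * M ^ r - M * m ^ r))) ^ r

open ContinuousLinearMap Polynomial

theorem one_le_kantorovich {m M : ℝ} (hm : 0 < m) (hmM : m < M) (i : ℕ) :
    1 ≤ kantorovich m M i := by
  unfold kantorovich
  split_ifs with h
  · exact le_rfl
  · have hi2 : 2 ≤ i := by
      by_contra hlt
      have : i = 0 ∨ i = 1 := by omega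
      rcases this with rfl | rfl <;> simp at h
    obtain ⟨n, rfl⟩ : ∃ n, i = n + 2 := ⟨i - 2, by omega⟩
    simp only [Real.rpow_natCast]
    have hM : 0 < M := hm.trans hmM
    have hmi : 0 < m ^ (n + 2) := pow_pos hm _
    have hlt : m ^ (n + 1) < M ^ (n + 1) := pow_lt_pow_left₀ hmM hm.le (by omega)
    have hlt' : m ^ (n + 2) < M ^ (n + 2) := pow_lt_pow_left₀ hmM hm.le (by omega)
    have hd : 0 < M - m := sub_pos.2 hmM
    have hr : (0 : ℝ) < ((n + 2 : ℕ) : ℝ) - 1 := by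
      push_cast
      linarith [(n.cast_nonneg : (0 : ℝ) ≤ n)]
    have hr0 : (0 : ℝ) < ((n + 2 : ℕ) : ℝ) := by linarith
    have hb : 0 < m * M ^ (n + 2) - M * m ^ (n + 2) := by
      have := mul_pos (mul_pos hm hM) (sub_pos.2 hlt)
      nlinarith [pow_succ m (n + 1), pow_succ M (n + 1)]
    have ha : 0 < M ^ (n + 2) - m ^ (n + 2) := sub_pos.2 hlt'
    -- Bernoulli's inequality at the point where the chord through `m` and `M` is rescaled.
    set b := m * M ^ (n + 2) - M * m ^ (n + 2) with hb_def
    set r : ℝ := ((n + 2 : ℕ) : ℝ) with hr_def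
    set u : ℝ := (r - 1) * (M ^ (n + 2) - m ^ (n + 2)) / (r * b) with hu_def
    have hu : 0 < u := by positivity
    have hbern : 1 + r * (m * u - 1) ≤ (m * u) ^ (n + 2) :=
      one_add_mul_sub_le_pow (by nlinarith [mul_pos hm hu]) (n + 2)
    have hC : 0 < b / ((r - 1) * (M - m)) := by positivity
    have key : b / ((r - 1) * (M - m)) * (1 + r * (m * u - 1)) = m ^ (n + 2) := by
      rw [hu_def]
      field_simp
      rw [hb_def]
      ring
    have h1 := mul_le_mul_of_nonneg_left hbern hC.le
    rw [key, mul_pow] at h1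
    refine le_of_mul_le_mul_left ?_ hmi
    linarith

section Compression

variable {H K : Type*} [NormedAddCommGroup H] [InnerProductSpace ℂ H] [CompleteSpace H]
  [NormedAddCommGroup K] [InnerProductSpace ℂ K] [CompleteSpace K]
  {ι : Type*} [Fintype ι]

theorem sum_smul_compression_mono (V : K →L[ℂ] H) {w : ι → ℝ} (hw : ∀ j, 0 ≤ w j)
    {X Y : ι → H →L[ℂ] H} (h : ∀ j, X j ≤ Y j) :
    ∑ j, w j • ((adjoint V) ∘L (X j) ∘L V) ≤ ∑ j, w j • ((adjoint V) ∘L (Y j) ∘L V) := by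
  rw [ContinuousLinearMap.le_def, ← Finset.sum_sub_distrib]
  refine ContinuousLinearMap.isPositive_sum _ fun j _ => ?_
  have h1 := ((ContinuousLinearMap.le_def _ _).1 (h j)).adjoint_conj V
  have h2 := h1.smul_of_nonneg (c := (w j : ℂ)) (by exact_mod_cast hw j)
  convert h2 using 1
  ext x
  simp [smul_sub]

theorem sum_smul_compression_algebraMap {V : K →L[ℂ] H} (hV : (adjoint V) ∘L V = 1)
    {w : ι → ℝ} (hw1 : ∑ j, w j = 1) (r : ℝ) :
    ∑ j, w j • ((adjoint V) ∘L (algebraMap ℝ (H →L[ℂ] H) r) ∘L V) =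
      algebraMap ℝ (K →L[ℂ] K) r := by
  have h : (adjoint V) ∘L (algebraMap ℝ (H →L[ℂ] H) r) ∘L V = r • (1 : K →L[ℂ] K) := by
    rw [← hV]
    ext x
    simp [Algebra.algebraMap_eq_smul_one]
  rw [← Finset.sum_smul, hw1, h, one_smul, Algebra.algebraMap_eq_smul_one]

theorem isSelfAdjoint_sum_smul_compression_cfc (V : K →L[ℂ] H) (w : ι → ℝ)
    (A : ι → H →L[ℂ] H) (q : ι → ℝ → ℝ) :
    IsSelfAdjoint (∑ j, w j • ((adjoint V) ∘L (cfc (q j) (A j)) ∘L V)) := by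
  refine isSelfAdjoint_sum _ fun j _ => IsSelfAdjoint.smul (IsSelfAdjoint.all _) ?_
  exact (cfc_predicate (q j) (A j) : IsSelfAdjoint _).adjoint_conj V

theorem spectrum_sum_smul_compression_cfc_subset_Icc
    {V : K →L[ℂ] H} (hV : (adjoint V) ∘L V = 1)
    {w : ι → ℝ} (hw : ∀ j, 0 ≤ w j) (hw1 : ∑ j, w j = 1)
    {A : ι → H →L[ℂ] H} (hA : ∀ j, IsSelfAdjoint (A j)) {q : ι → ℝ → ℝ}
    (hq : ∀ j, ContinuousOn (q j) (spectrum ℝ (A j))) {c d : ℝ}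
    (h : ∀ j, ∀ x ∈ spectrum ℝ (A j), q j x ∈ Set.Icc c d) :
    spectrum ℝ (∑ j, w j • ((adjoint V) ∘L (cfc (q j) (A j)) ∘L V)) ⊆ Set.Icc c d := by
  have hB := isSelfAdjoint_sum_smul_compression_cfc V w A q
  have hlo := sum_smul_compression_mono V hw fun j =>
    algebraMap_le_cfc (q j) c (A j) (fun x hx => (h j x hx).1) (hq j) (hA j)
  have hhi := sum_smul_compression_mono V hw fun j =>
    cfc_le_algebraMap (q j) d (A j) (fun x hx => (h j x hx).2) (hq j) (hA j)
  rw [sum_smul_compression_algebraMap hV hw1] at hlo hhi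
  exact fun x hx => ⟨(algebraMap_le_iff_le_spectrum hB).1 hlo x hx,
    (le_algebraMap_iff_spectrum_le hB).1 hhi x hx⟩

end Compression

theorem isCompact_closure_convexHull_of_subset_Ioo {T : Set ℝ} {c d : ℝ}
    (h : closure (convexHull ℝ T) ⊆ Set.Ioo c d) : IsCompact (closure (convexHull ℝ T)) :=
  Metric.isCompact_of_isClosed_isBounded isClosed_closure ((Metric.isBounded_Ioo c d).subset h)

theorem subset_Icc_sInf_sSup_of_isCompact {S : Set ℝ} (hS : IsCompact S) :
    S ⊆ Set.Icc (sInf S) (sSup S) :=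
  fun _ hx => ⟨csInf_le hS.bddBelow hx, le_csSup hS.bddAbove hx⟩

theorem Icc_sInf_sSup_subset_of_isCompact {S : Set ℝ} (hS : IsCompact S) (hne : S.Nonempty)
    (hconv : Convex ℝ S) : Set.Icc (sInf S) (sSup S) ⊆ S :=
  hconv.ordConnected.out (hS.sInf_mem hne) (hS.sSup_mem hne)

section LogBounds

variable {K : Type*} [NormedAddCommGroup K] [InnerProductSpace ℂ K] [CompleteSpace K]

theorem continuousOn_log_of_subset_Ioo {S : Set ℝ} (h01 : S ⊆ Set.Ioo (0 : ℝ) 1) :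
    ContinuousOn Real.log S :=
  Real.continuousOn_log.mono fun _ hx => (h01 hx).1.ne'

theorem isCompact_image_div_log {S : Set ℝ} (hS : IsCompact S) (h01 : S ⊆ Set.Ioo (0 : ℝ) 1) :
    IsCompact ((fun x => x / Real.log x) '' S) :=
  hS.image_of_continuousOn (continuousOn_id.div (continuousOn_log_of_subset_Ioo h01)
    fun _ hx => (Real.log_neg (h01 hx).1 (h01 hx).2).ne)

theorem le_sInf_div_log_smul_cfc_log {S : Set ℝ} (hS : IsCompact S)
    (h01 : S ⊆ Set.Ioo (0 : ℝ) 1) {B : K →L[ℂ] K} (hB : IsSelfAdjoint B)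
    (hspec : spectrum ℝ B ⊆ S) :
    B ≤ (sInf ((fun x => x / Real.log x) '' S)) • cfc Real.log B := by
  have hlog := (continuousOn_log_of_subset_Ioo h01).mono hspec
  rw [← cfc_smul _ Real.log B hlog]
  conv_lhs => rw [← cfc_id' ℝ B hB]
  refine cfc_mono (fun x hx => ?_) continuousOn_id (continuousOn_const.mul hlog)
  have hneg := Real.log_neg (h01 (hspec hx)).1 (h01 (hspec hx)).2
  have h := csInf_le (isCompact_image_div_log hS h01).bddBelow
    (Set.mem_image_of_mem (fun x => x / Real.log x) (hspec hx))
  exact (le_div_iff_of_neg hneg).1 h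

theorem sSup_div_log_smul_cfc_log_le {S : Set ℝ} (hS : IsCompact S)
    (h01 : S ⊆ Set.Ioo (0 : ℝ) 1) {B : K →L[ℂ] K} (hB : IsSelfAdjoint B)
    (hspec : spectrum ℝ B ⊆ S) :
    (sSup ((fun x => x / Real.log x) '' S)) • cfc Real.log B ≤ B := by
  have hlog := (continuousOn_log_of_subset_Ioo h01).mono hspec
  rw [← cfc_smul _ Real.log B hlog]
  conv_rhs => rw [← cfc_id' ℝ B hB]
  refine cfc_mono (fun x hx => ?_) (continuousOn_const.mul hlog) continuousOn_id
  have hneg := Real.log_neg (h01 (hspec hx)).1 (h01 (hspec hx)).2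
  have h := le_csSup (isCompact_image_div_log hS h01).bddAbove
    (Set.mem_image_of_mem (fun x => x / Real.log x) (hspec hx))
  exact (div_le_iff_of_neg hneg).1 h

end LogBounds

theorem sInf_image_Icc_pos {p : ℝ → ℝ} (hp : Continuous p) {c d : ℝ} (hcd : c ≤ d)
    (hpos : ∀ x ∈ Set.Icc c d, 0 < p x) : 0 < sInf (p '' Set.Icc c d) := by
  obtain ⟨x, hx, hxp⟩ := (isCompact_Icc.image hp).sInf_mem ((Set.nonempty_Icc.2 hcd).image p)
  exact hxp ▸ hpos x hx

theorem sum_mul_pow_le {I : ℕ} {a κ ρ : ℕ → ℝ} (hκ : ∀ i, 1 ≤ κ i) (hρ : ∀ i, 1 ≤ ρ i)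
    {l y u : ℝ} (hl : 0 ≤ l) (hly : l ≤ y) (hyu : y ≤ u) :
    ∑ i ∈ Finset.range (I + 1), a i * y ^ i ≤
      (∑ i ∈ (Finset.range (I + 1)).filter (fun i => 0 ≤ a i), a i * κ i * u ^ i) +
        ∑ i ∈ (Finset.range (I + 1)).filter (fun i => a i < 0), a i * (ρ i)⁻¹ * l ^ i := by
  rw [← Finset.sum_filter_add_sum_filter_not (Finset.range (I + 1)) (fun i => 0 ≤ a i)]
  simp only [not_le]
  refine add_le_add (Finset.sum_le_sum fun i hi => ?_) (Finset.sum_le_sum fun i hi => ?_)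
  · have h : y ^ i ≤ κ i * u ^ i :=
      (pow_le_pow_left₀ (hl.trans hly) hyu i).trans
        (le_mul_of_one_le_left (pow_nonneg (hl.trans (hly.trans hyu)) i) (hκ i))
    rw [mul_assoc]
    exact mul_le_mul_of_nonneg_left h (Finset.mem_filter.1 hi).2
  · have h : (ρ i)⁻¹ * l ^ i ≤ y ^ i :=
      (mul_le_of_le_one_left (pow_nonneg hl i) (inv_le_one_of_one_le₀ (hρ i))).trans
        (pow_le_pow_left₀ hl hly i)
    rw [mul_assoc]
    exact mul_le_mul_of_nonpos_left h (Finset.mem_filter.1 hi).2.le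

theorem le_sum_mul_pow {I : ℕ} {a κ ρ : ℕ → ℝ} (hκ : ∀ i, 1 ≤ κ i) (hρ : ∀ i, 1 ≤ ρ i)
    {l y u : ℝ} (hl : 0 ≤ l) (hly : l ≤ y) (hyu : y ≤ u) :
    (∑ i ∈ (Finset.range (I + 1)).filter (fun i => 0 ≤ a i), a i * (ρ i)⁻¹ * l ^ i) +
        ∑ i ∈ (Finset.range (I + 1)).filter (fun i => a i < 0), a i * κ i * u ^ i ≤
      ∑ i ∈ Finset.range (I + 1), a i * y ^ i := by
  rw [← Finset.sum_filter_add_sum_filter_not (Finset.range (I + 1)) (fun i => 0 ≤ a i)]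
  simp only [not_le]
  refine add_le_add (Finset.sum_le_sum fun i hi => ?_) (Finset.sum_le_sum fun i hi => ?_)
  · have h : (ρ i)⁻¹ * l ^ i ≤ y ^ i :=
      (mul_le_of_le_one_left (pow_nonneg hl i) (inv_le_one_of_one_le₀ (hρ i))).trans
        (pow_le_pow_left₀ hl hly i)
    rw [mul_assoc]
    exact mul_le_mul_of_nonneg_left h (Finset.mem_filter.1 hi).2
  · have h : y ^ i ≤ κ i * u ^ i :=
      (pow_le_pow_left₀ (hl.trans hly) hyu i).trans
        (le_mul_of_one_le_left (pow_nonneg (hl.trans (hly.trans hyu)) i) (hκ i))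
    rw [mul_assoc]
    exact mul_le_mul_of_nonpos_left h (Finset.mem_filter.1 hi).2.le

theorem sum_smul_cfc_pow {H : Type*} [NormedAddCommGroup H] [InnerProductSpace ℂ H]
    [CompleteSpace H] {T : H →L[ℂ] H} (hT : IsSelfAdjoint T) {f : ℝ → ℝ}
    (hf : ContinuousOn f (spectrum ℝ T)) (a : ℕ → ℝ) (s : Finset ℕ) :
    ∑ i ∈ s, a i • (cfc f T) ^ i = cfc (fun x => ∑ i ∈ s, a i * f x ^ i) T := by
  have h : (fun x => ∑ i ∈ s, a i * f x ^ i) = ∑ i ∈ s, fun x => a i • f x ^ i := by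
    ext x
    simp
  rw [h, cfc_sum (fun i x => a i • f x ^ i) T s fun i _ => continuousOn_const.mul (hf.pow i)]
  refine Finset.sum_congr rfl fun i _ => ?_
  rw [cfc_smul (a i) (fun x => f x ^ i) T (hf.pow i), cfc_pow f i T hf hT]

/-- The spectrum of a weighted compression of functions of operators lies in the closed convex
hull of the ranges of those functions, if this hull is bounded. -/
theorem spectrum_sum_smul_compression_cfc_subset_closure_convexHull
    {H K : Type*} [NormedAddCommGroup H] [InnerProductSpace ℂ H] [CompleteSpace H]
    [NormedAddCommGroup K] [InnerProductSpace ℂ K] [CompleteSpace K]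
    {ι : Type*} [Fintype ι] [Nonempty ι] {V : K →L[ℂ] H} (hV : (adjoint V) ∘L V = 1)
    {w : ι → ℝ} (hw : ∀ j, 0 ≤ w j) (hw1 : ∑ j, w j = 1)
    {A : ι → H →L[ℂ] H} (hA : ∀ j, IsSelfAdjoint (A j))
    {m M : ι → ℝ} (hmM : ∀ j, m j ≤ M j)
    (hspec : ∀ j, spectrum ℝ (A j) ⊆ Set.Icc (m j) (M j))
    {q : ι → ℝ → ℝ} (hq : ∀ j, Continuous (q j))
    (hS : IsCompact (closure (convexHull ℝ (⋃ j, q j '' Set.Icc (m j) (M j))))) :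
    spectrum ℝ (∑ j, w j • ((adjoint V) ∘L (cfc (q j) (A j)) ∘L V)) ⊆
      closure (convexHull ℝ (⋃ j, q j '' Set.Icc (m j) (M j))) := by
  have hmem : ∀ j, ∀ x ∈ Set.Icc (m j) (M j),
      q j x ∈ closure (convexHull ℝ (⋃ j, q j '' Set.Icc (m j) (M j))) := fun j x hx =>
    subset_closure (subset_convexHull ℝ _ (Set.mem_iUnion.2 ⟨j, x, hx, rfl⟩))
  obtain ⟨j₀⟩ := ‹Nonempty ι›
  refine (spectrum_sum_smul_compression_cfc_subset_Icc hV hw hw1 hA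
    (fun j => (hq j).continuousOn) fun j x hx =>
      subset_Icc_sInf_sSup_of_isCompact hS (hmem j x (hspec j hx))).trans ?_
  exact Icc_sInf_sSup_subset_of_isCompact hS ⟨_, hmem j₀ _ (Set.left_mem_Icc.2 (hmM j₀))⟩
    (convex_convexHull ℝ _).closure

theorem stmt12
    {H K : Type*} [NormedAddCommGroup H] [InnerProductSpace ℂ H] [CompleteSpace H]
    [NormedAddCommGroup K] [InnerProductSpace ℂ K] [CompleteSpace K]
    (V : K →L[ℂ] H) (hV : (adjoint V) ∘L V = 1)
    (I : ℕ) (a : ℕ → ℝ)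
    (k : ℕ) (hk : 1 ≤ k)
    (w : Fin k → ℝ) (hw : ∀ j, 0 ≤ w j) (hw1 : ∑ j, w j = 1)
    (m M : Fin k → ℝ) (hmM : ∀ j, m j < M j)
    (A : Fin k → H →L[ℂ] H) (hA : ∀ j, IsSelfAdjoint (A j))
    (hspec : ∀ j, spectrum ℝ (A j) ⊆ Set.Icc (m j) (M j))
    (f : ℝ → ℝ) (hf : ContinuousOn f (⋃ j, Set.Icc (m j) (M j)))
    (pL pU : Polynomial ℝ)
    (hp : ∀ x ∈ ⋃ j, Set.Icc (m j) (M j),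
      0 < pL.eval x ∧ pL.eval x ≤ f x ∧ f x ≤ pU.eval x)
    (mU MU mL ML : Fin k → ℝ)
    (hmU : ∀ j, mU j = sInf ((fun x => pU.eval x) '' Set.Icc (m j) (M j)))
    (hMU : ∀ j, MU j = sSup ((fun x => pU.eval x) '' Set.Icc (m j) (M j)))
    (hmL : ∀ j, mL j = sInf ((fun x => pL.eval x) '' Set.Icc (m j) (M j)))
    (hML : ∀ j, ML j = sSup ((fun x => pL.eval x) '' Set.Icc (m j) (M j)))
    (hUlt : ∀ j, mU j < MU j) (hLlt : ∀ j, mL j < ML j)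
    (qU qL : Fin k → ℝ → ℝ)
    (hqU : ∀ j x, qU j x =
      (∑ i ∈ (Finset.range (I + 1)).filter (fun i => 0 ≤ a i),
        a i * kantorovich (mU j) (MU j) (i : ℝ) * (pU.eval x) ^ i) +
      ∑ i ∈ (Finset.range (I + 1)).filter (fun i => a i < 0),
        a i * (kantorovich (mL j) (ML j) (i : ℝ))⁻¹ * (pL.eval x) ^ i)
    (hqL : ∀ j x, qL j x =
      (∑ i ∈ (Finset.range (I + 1)).filter (fun i => 0 ≤ a i),
        a i * (kantorovich (mL j) (ML j) (i : ℝ))⁻¹ * (pL.eval x) ^ i) +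
      ∑ i ∈ (Finset.range (I + 1)).filter (fun i => a i < 0),
        a i * kantorovich (mU j) (MU j) (i : ℝ) * (pU.eval x) ^ i)
    (BU BL : K →L[ℂ] K)
    (hBU : BU = ∑ j, w j • ((adjoint V) ∘L (cfc (qU j) (A j)) ∘L V))
    (hBL : BL = ∑ j, w j • ((adjoint V) ∘L (cfc (qL j) (A j)) ∘L V))
    (SU SL : Set ℝ)
    (hSU : SU = closure (convexHull ℝ (⋃ j, qU j '' Set.Icc (m j) (M j))))
    (hSL : SL = closure (convexHull ℝ (⋃ j, qL j '' Set.Icc (m j) (M j))))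
    (hSU01 : SU ⊆ Set.Ioo (0 : ℝ) 1) (hSL01 : SL ⊆ Set.Ioo (0 : ℝ) 1) :
    ((∑ j, w j • ((adjoint V) ∘L (∑ i ∈ Finset.range (I + 1), a i • (cfc f (A j)) ^ i) ∘L V)) ≤
      (sInf ((fun x => x / Real.log x) '' SU)) • cfc Real.log BU) ∧
    (sSup ((fun x => x / Real.log x) '' SL)) • cfc Real.log BL ≤
      (∑ j, w j • ((adjoint V) ∘L (∑ i ∈ Finset.range (I + 1), a i • (cfc f (A j)) ^ i) ∘L V)) := by
  have hmem : ∀ j, ∀ x ∈ Set.Icc (m j) (M j), x ∈ ⋃ j, Set.Icc (m j) (M j) :=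
    fun j x hx => Set.mem_iUnion.2 ⟨j, hx⟩
  have hmU0 : ∀ j, 0 < mU j := fun j => by
    rw [hmU j]
    refine sInf_image_Icc_pos pU.continuous (hmM j).le fun x hx => ?_
    obtain ⟨h1, h2, h3⟩ := hp x (hmem j x hx)
    linarith
  have hmL0 : ∀ j, 0 < mL j := fun j => by
    rw [hmL j]
    exact sInf_image_Icc_pos pL.continuous (hmM j).le fun x hx => (hp x (hmem j x hx)).1
  have hκ := fun j i => one_le_kantorovich (hmU0 j) (hUlt j) i
  have hρ := fun j i => one_le_kantorovich (hmL0 j) (hLlt j) i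
  have hcU : ∀ j, Continuous (qU j) := fun j => by
    rw [funext (hqU j)]
    fun_prop
  have hcL : ∀ j, Continuous (qL j) := fun j => by
    rw [funext (hqL j)]
    fun_prop
  have hfA : ∀ j, ContinuousOn f (spectrum ℝ (A j)) := fun j =>
    hf.mono fun x hx => hmem j x (hspec j hx)
  have hfsum : ∀ j, ContinuousOn (fun x => ∑ i ∈ Finset.range (I + 1), a i * f x ^ i)
      (spectrum ℝ (A j)) := fun j =>
    continuousOn_finsetSum _ fun i _ => continuousOn_const.mul ((hfA j).pow i)
  have : Nonempty (Fin k) := ⟨⟨0, hk⟩⟩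
  subst hSU hSL hBU hBL
  have hSUc := isCompact_closure_convexHull_of_subset_Ioo hSU01
  have hSLc := isCompact_closure_convexHull_of_subset_Ioo hSL01
  simp only [fun j => sum_smul_cfc_pow (hA j) (hfA j) a]
  constructor
  · refine (sum_smul_compression_mono V hw fun j =>
      cfc_mono (fun x hx => ?_) (hfsum j) (hcU j).continuousOn).trans
      (le_sInf_div_log_smul_cfc_log hSUc hSU01
        (isSelfAdjoint_sum_smul_compression_cfc V w A qU)
        (spectrum_sum_smul_compression_cfc_subset_closure_convexHull hV hw hw1 hA
          (fun j => (hmM j).le) hspec hcU hSUc))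
    obtain ⟨h1, h2, h3⟩ := hp x (hmem j x (hspec j hx))
    rw [hqU j x]
    exact sum_mul_pow_le (hκ j) (hρ j) h1.le h2 h3
  · refine (sSup_div_log_smul_cfc_log_le hSLc hSL01
        (isSelfAdjoint_sum_smul_compression_cfc V w A qL)
        (spectrum_sum_smul_compression_cfc_subset_closure_convexHull hV hw hw1 hA
          (fun j => (hmM j).le) hspec hcL hSLc)).trans
      (sum_smul_compression_mono V hw fun j =>
        cfc_mono (fun x hx => ?_) (hcL j).continuousOn (hfsum j))
    obtain ⟨h1, h2, h3⟩ := hp x (hmem j x (hspec j hx))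
    rw [hqL j x]
    exact le_sum_mul_pow (hκ j) (hρ j) h1.le h2 h3
end

section
/- Assume S_U ⊆ (0, ∞) and S_L ⊆ (0, ∞), and let q ∈ ℝ. Then Σ_{j=1}^k w_j Φ(f(A_j)) − B_U^q ≤ ( max_{x ∈ S_U} (x − x^q) )·1_K, and Σ_{j=1}^k w_j Φ(f(A_j)) − B_L^q ≥ ( min_{x ∈ S_L} (x − x^q) )·1_K, in the Loewner order, where the operator powers are defined by continuous functional calculus and 1_K is the identity operator on K. -/
open ContinuousLinearMap Polynomial

/-- The Kantorovich constant of a natural exponent is at least `1`. -/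
theorem one_le_kantorovich_natCast {m M : ℝ} (hm : 0 < m) (hmM : m < M) (n : ℕ) :
    1 ≤ kantorovich m M (n : ℝ) := by
  unfold kantorovich
  split_ifs with h
  · exact le_rfl
  have h0 : n ≠ 0 := fun h' => h (Or.inl (by simp [h']))
  have h1 : n ≠ 1 := fun h' => h (Or.inr (by simp [h']))
  obtain ⟨k, rfl⟩ : ∃ k, n = k + 2 := ⟨n - 2, by omega⟩
  simp only [Real.rpow_natCast]
  have hM : 0 < M := hm.trans hmM
  have hd : 0 < M - m := sub_pos.2 hmM
  have hn : (0 : ℝ) < ((k + 2 : ℕ) : ℝ) - 1 := by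
    push_cast
    have : (0 : ℝ) ≤ k := k.cast_nonneg
    linarith
  have hn' : (0 : ℝ) < ((k + 2 : ℕ) : ℝ) := by linarith
  have hpow : m ^ (k + 1) < M ^ (k + 1) := pow_lt_pow_left₀ hmM hm.le (by omega)
  have hpow' : m ^ (k + 2) < M ^ (k + 2) := pow_lt_pow_left₀ hmM hm.le (by omega)
  have hν : 0 < m * M ^ (k + 2) - M * m ^ (k + 2) := by
    have : m * M ^ (k + 2) - M * m ^ (k + 2) = (m * M) * (M ^ (k + 1) - m ^ (k + 1)) := by ring
    rw [this]
    exact mul_pos (mul_pos hm hM) (sub_pos.2 hpow)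
  generalize hν' : m * M ^ (k + 2) - M * m ^ (k + 2) = ν at *
  generalize hr : ((k + 2 : ℕ) : ℝ) = r at *
  set s : ℝ := ((r - 1) * (M ^ (k + 2) - m ^ (k + 2))) / (r * ν) with hs
  have hs0 : 0 < s := div_pos (mul_pos hn (sub_pos.2 hpow')) (mul_pos hn' hν)
  have hB : 1 + r * (s * m - 1) ≤ (s * m) ^ (k + 2) := by
    have := one_add_mul_le_pow (a := s * m - 1) (by nlinarith [mul_pos hs0 hm]) (k + 2)
    rw [hr] at this
    simpa using this
  have hmn : 0 < m ^ (k + 2) := pow_pos hm _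
  have key : ν / ((r - 1) * (M - m)) * (1 + r * (s * m - 1)) = m ^ (k + 2) := by
    rw [hs]
    field_simp
    rw [← hν']
    ring
  have hc : 0 < ν / ((r - 1) * (M - m)) := div_pos hν (mul_pos hn hd)
  have h2 := mul_le_mul_of_nonneg_left hB hc.le
  rw [key, mul_pow, ← mul_assoc] at h2
  exact le_of_mul_le_mul_right (by simpa using h2) hmn

/-- Termwise comparison of a polynomial expression in `y`, according to the signs of its
coefficients. -/
theorem sum_mul_pow_le_of_mem_Icc (s : Finset ℕ) (a c d : ℕ → ℝ) {l y u : ℝ}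
    (hl : 0 < l) (hly : l ≤ y) (hyu : y ≤ u) (hc : ∀ i, 1 ≤ c i) (hd : ∀ i, 1 ≤ d i) :
    ∑ i ∈ s, a i * y ^ i ≤
      (∑ i ∈ s.filter (fun i => 0 ≤ a i), a i * c i * u ^ i) +
        ∑ i ∈ s.filter (fun i => a i < 0), a i * (d i)⁻¹ * l ^ i := by
  rw [← Finset.sum_filter_add_sum_filter_not s (fun i => 0 ≤ a i)]
  simp only [not_le]
  have hy : 0 < y := hl.trans_le hly
  refine add_le_add (Finset.sum_le_sum fun i hi => ?_) (Finset.sum_le_sum fun i hi => ?_)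
  · rw [mul_assoc]
    refine mul_le_mul_of_nonneg_left ?_ (Finset.mem_filter.1 hi).2
    calc y ^ i ≤ u ^ i := pow_le_pow_left₀ hy.le hyu i
      _ ≤ c i * u ^ i := le_mul_of_one_le_left (pow_nonneg (hy.le.trans hyu) i) (hc i)
  · rw [mul_assoc]
    refine mul_le_mul_of_nonpos_left ?_ (Finset.mem_filter.1 hi).2.le
    calc (d i)⁻¹ * l ^ i ≤ l ^ i :=
          mul_le_of_le_one_left (pow_nonneg hl.le i) (inv_le_one_of_one_le₀ (hd i))
      _ ≤ y ^ i := pow_le_pow_left₀ hl.le hly i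

theorem le_sum_mul_pow_of_mem_Icc (s : Finset ℕ) (a c d : ℕ → ℝ) {l y u : ℝ}
    (hl : 0 < l) (hly : l ≤ y) (hyu : y ≤ u) (hc : ∀ i, 1 ≤ c i) (hd : ∀ i, 1 ≤ d i) :
    (∑ i ∈ s.filter (fun i => 0 ≤ a i), a i * (d i)⁻¹ * l ^ i) +
        ∑ i ∈ s.filter (fun i => a i < 0), a i * c i * u ^ i ≤
      ∑ i ∈ s, a i * y ^ i := by
  rw [← Finset.sum_filter_add_sum_filter_not s (fun i => 0 ≤ a i)]
  simp only [not_le]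
  have hy : 0 < y := hl.trans_le hly
  refine add_le_add (Finset.sum_le_sum fun i hi => ?_) (Finset.sum_le_sum fun i hi => ?_)
  · rw [mul_assoc]
    refine mul_le_mul_of_nonneg_left ?_ (Finset.mem_filter.1 hi).2
    calc (d i)⁻¹ * l ^ i ≤ l ^ i :=
          mul_le_of_le_one_left (pow_nonneg hl.le i) (inv_le_one_of_one_le₀ (hd i))
      _ ≤ y ^ i := pow_le_pow_left₀ hl.le hly i
  · rw [mul_assoc]
    refine mul_le_mul_of_nonpos_left ?_ (Finset.mem_filter.1 hi).2.le
    calc y ^ i ≤ u ^ i := pow_le_pow_left₀ hy.le hyu i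
      _ ≤ c i * u ^ i := le_mul_of_one_le_left (pow_nonneg (hy.le.trans hyu) i) (hc i)

theorem sInf_image_Icc_pos_s16 {g : ℝ → ℝ} {a b : ℝ} (hab : a ≤ b)
    (hg : ContinuousOn g (Set.Icc a b)) (hpos : ∀ x ∈ Set.Icc a b, 0 < g x) :
    0 < sInf (g '' Set.Icc a b) := by
  obtain ⟨x, hx, hxe⟩ := (isCompact_Icc.image_of_continuousOn hg).sInf_mem
    ((Set.nonempty_Icc.2 hab).image g)
  rw [← hxe]
  exact hpos x hx

theorem isCompact_closure_convexHull_iUnion_image {ι : Type*} [Finite ι] (m M : ι → ℝ)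
    (g : ι → ℝ → ℝ) (hg : ∀ j, Continuous (g j)) :
    IsCompact (closure (convexHull ℝ (⋃ j, g j '' Set.Icc (m j) (M j)))) := by
  have h : IsCompact (⋃ j, g j '' Set.Icc (m j) (M j)) :=
    isCompact_iUnion fun j => isCompact_Icc.image (hg j)
  exact (isBounded_convexHull.2 h.isBounded).isCompact_closure

section Operators

variable {H K : Type*} [NormedAddCommGroup H] [InnerProductSpace ℂ H] [CompleteSpace H]
    [NormedAddCommGroup K] [InnerProductSpace ℂ K] [CompleteSpace K]

theorem adjoint_comp_comp_mono (V : K →L[ℂ] H) {S T : H →L[ℂ] H} (h : S ≤ T) :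
    (adjoint V) ∘L S ∘L V ≤ (adjoint V) ∘L T ∘L V := by
  rw [ContinuousLinearMap.le_def] at h ⊢
  convert h.adjoint_conj V using 1
  ext
  simp

theorem sum_smul_adjoint_comp_comp_mono {ι : Type*} [Fintype ι] (V : K →L[ℂ] H) {w : ι → ℝ}
    (hw : ∀ j, 0 ≤ w j) {S T : ι → H →L[ℂ] H} (h : ∀ j, S j ≤ T j) :
    ∑ j, w j • ((adjoint V) ∘L S j ∘L V) ≤ ∑ j, w j • ((adjoint V) ∘L T j ∘L V) :=
  Finset.sum_le_sum fun j _ =>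
    smul_le_smul_of_nonneg_left (adjoint_comp_comp_mono V (h j)) (hw j)

theorem sum_smul_adjoint_comp_algebraMap_comp {ι : Type*} [Fintype ι] {V : K →L[ℂ] H}
    (hV : (adjoint V) ∘L V = 1) {w : ι → ℝ} (hw1 : ∑ j, w j = 1) (c : ℝ) :
    ∑ j, w j • ((adjoint V) ∘L (algebraMap ℝ (H →L[ℂ] H) c) ∘L V) =
      algebraMap ℝ (K →L[ℂ] K) c := by
  have h : (adjoint V) ∘L (algebraMap ℝ (H →L[ℂ] H) c) ∘L V = algebraMap ℝ (K →L[ℂ] K) c := by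
    rw [Algebra.algebraMap_eq_smul_one, Algebra.algebraMap_eq_smul_one, ← hV]
    ext x
    simp
  rw [h, ← Finset.sum_smul, hw1, one_smul]

/-- A convex combination of compressions of the operators `g j (A j)` is self-adjoint, with
spectrum in the closed convex hull of the values of the `g j`. -/
theorem isSelfAdjoint_and_spectrum_subset_closure_convexHull {ι : Type*} [Fintype ι]
    [Nonempty ι] {V : K →L[ℂ] H} (hV : (adjoint V) ∘L V = 1)
    {w : ι → ℝ} (hw : ∀ j, 0 ≤ w j) (hw1 : ∑ j, w j = 1)
    {m M : ι → ℝ} (hmM : ∀ j, m j ≤ M j)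
    {A : ι → H →L[ℂ] H} (hA : ∀ j, IsSelfAdjoint (A j))
    (hspec : ∀ j, spectrum ℝ (A j) ⊆ Set.Icc (m j) (M j))
    {g : ι → ℝ → ℝ} (hg : ∀ j, Continuous (g j)) :
    IsSelfAdjoint (∑ j, w j • ((adjoint V) ∘L (cfc (g j) (A j)) ∘L V)) ∧
      spectrum ℝ (∑ j, w j • ((adjoint V) ∘L (cfc (g j) (A j)) ∘L V)) ⊆
        closure (convexHull ℝ (⋃ j, g j '' Set.Icc (m j) (M j))) := by
  set B : K →L[ℂ] K := ∑ j, w j • ((adjoint V) ∘L (cfc (g j) (A j)) ∘L V)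
  set S := closure (convexHull ℝ (⋃ j, g j '' Set.Icc (m j) (M j))) with hS
  have hB : IsSelfAdjoint B := by
    refine isSelfAdjoint_sum _ fun j _ => ?_
    exact IsSelfAdjoint.smul (IsSelfAdjoint.all _)
      ((cfc_predicate (g j) (A j)).adjoint_conj V)
  have hcpt : IsCompact S := isCompact_closure_convexHull_iUnion_image m M g hg
  have hmem : ∀ j, ∀ x ∈ spectrum ℝ (A j), g j x ∈ S := fun j x hx =>
    subset_closure (subset_convexHull ℝ _ (Set.mem_iUnion.2 ⟨j, x, hspec j hx, rfl⟩))
  have hne : S.Nonempty := by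
    let j := Classical.arbitrary ι
    exact ⟨g j (m j), subset_closure (subset_convexHull ℝ _
      (Set.mem_iUnion.2 ⟨j, m j, Set.left_mem_Icc.2 (hmM j), rfl⟩))⟩
  have hconv : Convex ℝ S := (convex_convexHull ℝ _).closure
  have hupper : B ≤ algebraMap ℝ (K →L[ℂ] K) (sSup S) := by
    rw [← sum_smul_adjoint_comp_algebraMap_comp hV hw1]
    exact sum_smul_adjoint_comp_comp_mono V hw fun j =>
      cfc_le_algebraMap _ _ _ (fun x hx => le_csSup hcpt.bddAbove (hmem j x hx))
        (hg j).continuousOn (hA j)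
  have hlower : algebraMap ℝ (K →L[ℂ] K) (sInf S) ≤ B := by
    rw [← sum_smul_adjoint_comp_algebraMap_comp hV hw1]
    exact sum_smul_adjoint_comp_comp_mono V hw fun j =>
      algebraMap_le_cfc _ _ _ (fun x hx => csInf_le hcpt.bddBelow (hmem j x hx))
        (hg j).continuousOn (hA j)
  refine ⟨hB, fun x hx => ?_⟩
  exact hconv.ordConnected.out (hcpt.sInf_mem hne) (hcpt.sSup_mem hne)
    ⟨(algebraMap_le_iff_le_spectrum hB).1 hlower x hx,
      (le_algebraMap_iff_spectrum_le hB).1 hupper x hx⟩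

theorem cfc_sum_mul_pow {A : H →L[ℂ] H} (hA : IsSelfAdjoint A) {f : ℝ → ℝ}
    (hf : ContinuousOn f (spectrum ℝ A)) (s : Finset ℕ) (a : ℕ → ℝ) :
    cfc (fun x => ∑ i ∈ s, a i * f x ^ i) A = ∑ i ∈ s, a i • (cfc f A) ^ i := by
  have h : (fun x => ∑ i ∈ s, a i * f x ^ i) = ∑ i ∈ s, fun x => a i * f x ^ i := by
    ext x
    simp
  rw [h, cfc_sum (fun i x => a i * f x ^ i) A s fun i _ => continuousOn_const.mul (hf.pow i)]
  refine Finset.sum_congr rfl fun i _ => ?_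
  rw [cfc_const_mul (a i) (fun x => f x ^ i) A (hf.pow i), cfc_pow f i A hf hA]

theorem continuousOn_rpow_const_of_subset_Ioi {S : Set ℝ} (hS : S ⊆ Set.Ioi 0) (q : ℝ) :
    ContinuousOn (fun x : ℝ => x ^ q) S := fun x hx =>
  (Real.continuousAt_rpow_const x q (Or.inl (hS hx).ne')).continuousWithinAt

theorem sub_cfc_rpow_eq {B : K →L[ℂ] K} (hB : IsSelfAdjoint B) {S : Set ℝ}
    (hBS : spectrum ℝ B ⊆ S) (hS : S ⊆ Set.Ioi 0) (q : ℝ) :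
    B - cfc (fun x : ℝ => x ^ q) B = cfc (fun x : ℝ => x - x ^ q) B := by
  rw [cfc_sub (fun x => x) _ B continuousOn_id
    (continuousOn_rpow_const_of_subset_Ioi (hBS.trans hS) q), cfc_id' ℝ B hB]

theorem sub_cfc_rpow_le {B : K →L[ℂ] K} (hB : IsSelfAdjoint B) {S : Set ℝ}
    (hc : IsCompact S) (hBS : spectrum ℝ B ⊆ S) (hS : S ⊆ Set.Ioi 0) (q : ℝ) :
    B - cfc (fun x : ℝ => x ^ q) B ≤ sSup ((fun x : ℝ => x - x ^ q) '' S) • 1 := by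
  have hcont : ContinuousOn (fun x : ℝ => x - x ^ q) S :=
    continuousOn_id.sub (continuousOn_rpow_const_of_subset_Ioi hS q)
  rw [sub_cfc_rpow_eq hB hBS hS, ← Algebra.algebraMap_eq_smul_one]
  exact cfc_le_algebraMap _ _ _ (fun x hx => le_csSup (hc.image_of_continuousOn hcont).bddAbove
    (Set.mem_image_of_mem _ (hBS hx))) (hcont.mono hBS) hB

theorem le_sub_cfc_rpow {B : K →L[ℂ] K} (hB : IsSelfAdjoint B) {S : Set ℝ}
    (hc : IsCompact S) (hBS : spectrum ℝ B ⊆ S) (hS : S ⊆ Set.Ioi 0) (q : ℝ) :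
    sInf ((fun x : ℝ => x - x ^ q) '' S) • 1 ≤ B - cfc (fun x : ℝ => x ^ q) B := by
  have hcont : ContinuousOn (fun x : ℝ => x - x ^ q) S :=
    continuousOn_id.sub (continuousOn_rpow_const_of_subset_Ioi hS q)
  rw [sub_cfc_rpow_eq hB hBS hS, ← Algebra.algebraMap_eq_smul_one]
  exact algebraMap_le_cfc _ _ _ (fun x hx => csInf_le (hc.image_of_continuousOn hcont).bddBelow
    (Set.mem_image_of_mem _ (hBS hx))) (hcont.mono hBS) hB

end Operators

theorem stmt16
    {H K : Type*} [NormedAddCommGroup H] [InnerProductSpace ℂ H] [CompleteSpace H]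
    [NormedAddCommGroup K] [InnerProductSpace ℂ K] [CompleteSpace K]
    (V : K →L[ℂ] H) (hV : (adjoint V) ∘L V = 1)
    (I : ℕ) (a : ℕ → ℝ)
    (k : ℕ) (hk : 1 ≤ k)
    (w : Fin k → ℝ) (hw : ∀ j, 0 ≤ w j) (hw1 : ∑ j, w j = 1)
    (m M : Fin k → ℝ) (hmM : ∀ j, m j < M j)
    (A : Fin k → H →L[ℂ] H) (hA : ∀ j, IsSelfAdjoint (A j))
    (hspec : ∀ j, spectrum ℝ (A j) ⊆ Set.Icc (m j) (M j))
    (f : ℝ → ℝ) (hf : ContinuousOn f (⋃ j, Set.Icc (m j) (M j)))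
    (pL pU : Polynomial ℝ)
    (hp : ∀ x ∈ ⋃ j, Set.Icc (m j) (M j),
      0 < pL.eval x ∧ pL.eval x ≤ f x ∧ f x ≤ pU.eval x)
    (mU MU mL ML : Fin k → ℝ)
    (hmU : ∀ j, mU j = sInf ((fun x => pU.eval x) '' Set.Icc (m j) (M j)))
    (hMU : ∀ j, MU j = sSup ((fun x => pU.eval x) '' Set.Icc (m j) (M j)))
    (hmL : ∀ j, mL j = sInf ((fun x => pL.eval x) '' Set.Icc (m j) (M j)))
    (hML : ∀ j, ML j = sSup ((fun x => pL.eval x) '' Set.Icc (m j) (M j)))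
    (hUlt : ∀ j, mU j < MU j) (hLlt : ∀ j, mL j < ML j)
    (qU qL : Fin k → ℝ → ℝ)
    (hqU : ∀ j x, qU j x =
      (∑ i ∈ (Finset.range (I + 1)).filter (fun i => 0 ≤ a i),
        a i * kantorovich (mU j) (MU j) (i : ℝ) * (pU.eval x) ^ i) +
      ∑ i ∈ (Finset.range (I + 1)).filter (fun i => a i < 0),
        a i * (kantorovich (mL j) (ML j) (i : ℝ))⁻¹ * (pL.eval x) ^ i)
    (hqL : ∀ j x, qL j x =
      (∑ i ∈ (Finset.range (I + 1)).filter (fun i => 0 ≤ a i),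
        a i * (kantorovich (mL j) (ML j) (i : ℝ))⁻¹ * (pL.eval x) ^ i) +
      ∑ i ∈ (Finset.range (I + 1)).filter (fun i => a i < 0),
        a i * kantorovich (mU j) (MU j) (i : ℝ) * (pU.eval x) ^ i)
    (BU BL : K →L[ℂ] K)
    (hBU : BU = ∑ j, w j • ((adjoint V) ∘L (cfc (qU j) (A j)) ∘L V))
    (hBL : BL = ∑ j, w j • ((adjoint V) ∘L (cfc (qL j) (A j)) ∘L V))
    (SU SL : Set ℝ)
    (hSU : SU = closure (convexHull ℝ (⋃ j, qU j '' Set.Icc (m j) (M j))))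
    (hSL : SL = closure (convexHull ℝ (⋃ j, qL j '' Set.Icc (m j) (M j))))
    (hSUpos : SU ⊆ Set.Ioi (0 : ℝ)) (hSLpos : SL ⊆ Set.Ioi (0 : ℝ))
    (q : ℝ) :
    ((∑ j, w j • ((adjoint V) ∘L (∑ i ∈ Finset.range (I + 1), a i • (cfc f (A j)) ^ i) ∘L V)) - cfc (fun x : ℝ => x ^ q) BU ≤
      (sSup ((fun x : ℝ => x - x ^ q) '' SU)) • (1 : K →L[ℂ] K)) ∧
    (sInf ((fun x : ℝ => x - x ^ q) '' SL)) • (1 : K →L[ℂ] K) ≤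
      (∑ j, w j • ((adjoint V) ∘L (∑ i ∈ Finset.range (I + 1), a i • (cfc f (A j)) ^ i) ∘L V)) - cfc (fun x : ℝ => x ^ q) BL := by
  have : Nonempty (Fin k) := ⟨⟨0, hk⟩⟩
  have hsub : ∀ j, Set.Icc (m j) (M j) ⊆ ⋃ j, Set.Icc (m j) (M j) :=
    fun j => Set.subset_iUnion (fun j => Set.Icc (m j) (M j)) j
  have hcU : ∀ j, Continuous (qU j) := fun j => by
    rw [funext (hqU j)]
    fun_prop
  have hcL : ∀ j, Continuous (qL j) := fun j => by
    rw [funext (hqL j)]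
    fun_prop
  have hKU : ∀ j (i : ℕ), 1 ≤ kantorovich (mU j) (MU j) (i : ℝ) := fun j i => by
    refine one_le_kantorovich_natCast ?_ (hUlt j) i
    rw [hmU j]
    refine sInf_image_Icc_pos_s16 (hmM j).le pU.continuous.continuousOn fun x hx => ?_
    obtain ⟨h1, h2, h3⟩ := hp x (hsub j hx)
    linarith
  have hKL : ∀ j (i : ℕ), 1 ≤ kantorovich (mL j) (ML j) (i : ℝ) := fun j i => by
    refine one_le_kantorovich_natCast ?_ (hLlt j) i
    rw [hmL j]
    exact sInf_image_Icc_pos_s16 (hmM j).le pL.continuous.continuousOn fun x hx =>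
      (hp x (hsub j hx)).1
  have hfs : ∀ j, ContinuousOn f (spectrum ℝ (A j)) := fun j =>
    hf.mono ((hspec j).trans (hsub j))
  have hcP : ∀ j, ContinuousOn (fun x => ∑ i ∈ Finset.range (I + 1), a i * f x ^ i)
      (spectrum ℝ (A j)) := fun j =>
    continuousOn_finsetSum _ fun i _ => continuousOn_const.mul ((hfs j).pow i)
  obtain ⟨hsaU, hspU⟩ := isSelfAdjoint_and_spectrum_subset_closure_convexHull hV hw hw1
    (fun j => (hmM j).le) hA hspec hcU
  obtain ⟨hsaL, hspL⟩ := isSelfAdjoint_and_spectrum_subset_closure_convexHull hV hw hw1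
    (fun j => (hmM j).le) hA hspec hcL
  rw [← hBU, ← hSU] at hspU
  rw [← hBU] at hsaU
  rw [← hBL, ← hSL] at hspL
  rw [← hBL] at hsaL
  have hcptU : IsCompact SU := hSU ▸ isCompact_closure_convexHull_iUnion_image m M qU hcU
  have hcptL : IsCompact SL := hSL ▸ isCompact_closure_convexHull_iUnion_image m M qL hcL
  constructor
  · refine le_trans (sub_le_sub_right ?_ _) (sub_cfc_rpow_le hsaU hcptU hspU hSUpos q)
    rw [hBU]
    refine sum_smul_adjoint_comp_comp_mono V hw fun j => ?_
    rw [← cfc_sum_mul_pow (hA j) (hfs j)]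
    refine cfc_mono (fun x hx => ?_) (hcP j) (hcU j).continuousOn
    obtain ⟨h1, h2, h3⟩ := hp x (hsub j (hspec j hx))
    rw [hqU]
    exact sum_mul_pow_le_of_mem_Icc _ a _ _ h1 h2 h3 (hKU j) (hKL j)
  · refine le_trans (le_sub_cfc_rpow hsaL hcptL hspL hSLpos q) (sub_le_sub_right ?_ _)
    rw [hBL]
    refine sum_smul_adjoint_comp_comp_mono V hw fun j => ?_
    rw [← cfc_sum_mul_pow (hA j) (hfs j)]
    refine cfc_mono (fun x hx => ?_) (hcL j).continuousOn (hcP j)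
    obtain ⟨h1, h2, h3⟩ := hp x (hsub j (hspec j hx))
    rw [hqL]
    exact le_sum_mul_pow_of_mem_Icc _ a _ _ h1 h2 h3 (hKU j) (hKL j)
end
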